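/- arXiv:2110.03636 — 4 statements merged into one kernel-verified Lean document; each statement's English description precedes it below -/
import Mathlib

section
/- Let H̃ be an n×n real symmetric matrix and J an m×n real matrix with full row rank and m < n, and assume H̃ is positive definite on the nullspace of J. Let G := {γ ≥ 0 : H_γ := H̃ + γ JᵀJ is symmetric positive definite}. Then G is nonempty and the function γ ↦ κ(H_γ) attains its infimum on G: there exists γ* ∈ G such that κ(H_{γ*}) ≤ κ(H_γ) for all γ ∈ G. -/
open Matrix

section RayleighBounds

variable {ι : Type*} [Fintype ι] [DecidableEq ι] {A : Matrix ι ι ℝ}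

theorem Matrix.IsHermitian.dotProduct_mulVec_le_iSup_eigenvalues
    (hA : A.IsHermitian) (v : ι → ℝ) :
    v ⬝ᵥ A *ᵥ v ≤ (⨆ i, hA.eigenvalues i) * (v ⬝ᵥ v) := by
  set M := ⨆ i, hA.eigenvalues i
  have hB : (algebraMap ℝ (Matrix ι ι ℝ) M - A).IsHermitian :=
    (by simp [Matrix.algebraMap_eq_diagonal] : (algebraMap ℝ (Matrix ι ι ℝ) M).IsHermitian).sub hA
  have hpsd : (algebraMap ℝ (Matrix ι ι ℝ) M - A).PosSemidef := by
    refine hB.posSemidef_iff_eigenvalues_nonneg.2 fun i => ?_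
    have h := hB.eigenvalues_mem_spectrum_real i
    rw [← spectrum.singleton_sub_eq, hA.spectrum_real_eq_range_eigenvalues] at h
    obtain ⟨_, rfl, _, ⟨j, rfl⟩, h⟩ := h
    rw [← h]
    exact sub_nonneg.2 (le_ciSup (Set.finite_range _).bddAbove j)
  have h := hpsd.dotProduct_mulVec_nonneg v
  simp only [Algebra.algebraMap_eq_smul_one, sub_mulVec, smul_mulVec, one_mulVec,
    star_trivial, dotProduct_sub, dotProduct_smul, smul_eq_mul] at h
  linarith

theorem Matrix.IsHermitian.iInf_eigenvalues_mul_le_dotProduct_mulVec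
    (hA : A.IsHermitian) (v : ι → ℝ) :
    (⨅ i, hA.eigenvalues i) * (v ⬝ᵥ v) ≤ v ⬝ᵥ A *ᵥ v := by
  set M := ⨅ i, hA.eigenvalues i
  have hB : (A - algebraMap ℝ (Matrix ι ι ℝ) M).IsHermitian :=
    hA.sub (by simp [Matrix.algebraMap_eq_diagonal] :
      (algebraMap ℝ (Matrix ι ι ℝ) M).IsHermitian)
  have hpsd : (A - algebraMap ℝ (Matrix ι ι ℝ) M).PosSemidef := by
    refine hB.posSemidef_iff_eigenvalues_nonneg.2 fun i => ?_
    have h := hB.eigenvalues_mem_spectrum_real i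
    rw [← spectrum.sub_singleton_eq, hA.spectrum_real_eq_range_eigenvalues] at h
    obtain ⟨_, ⟨j, rfl⟩, _, rfl, h⟩ := h
    rw [← h]
    exact sub_nonneg.2 (ciInf_le (Set.finite_range _).bddBelow j)
  have h := hpsd.dotProduct_mulVec_nonneg v
  simp only [Algebra.algebraMap_eq_smul_one, sub_mulVec, smul_mulVec, one_mulVec,
    star_trivial, dotProduct_sub, dotProduct_smul, smul_eq_mul] at h
  linarith

theorem Matrix.IsHermitian.exists_dotProduct_mulVec_eq_eigenvalues
    (hA : A.IsHermitian) (i : ι) :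
    ∃ v : ι → ℝ, v ⬝ᵥ v = 1 ∧ v ⬝ᵥ A *ᵥ v = hA.eigenvalues i := by
  have h1 : ⇑(hA.eigenvectorBasis i) ⬝ᵥ ⇑(hA.eigenvectorBasis i) = 1 := by
    have h := hA.eigenvectorBasis.orthonormal.1 i
    have h2 := EuclideanSpace.real_norm_sq_eq (hA.eigenvectorBasis i)
    rw [h] at h2
    simp only [dotProduct, ← sq]
    linarith
  refine ⟨_, h1, ?_⟩
  rw [hA.mulVec_eigenvectorBasis, dotProduct_smul, h1, smul_eq_mul, mul_one]

theorem Matrix.IsHermitian.exists_dotProduct_mulVec_eq_iSup [Nonempty ι] (hA : A.IsHermitian) :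
    ∃ v : ι → ℝ, v ⬝ᵥ v = 1 ∧ v ⬝ᵥ A *ᵥ v = ⨆ i, hA.eigenvalues i := by
  obtain ⟨i, hi⟩ := exists_eq_ciSup_of_finite (f := hA.eigenvalues)
  exact hi ▸ hA.exists_dotProduct_mulVec_eq_eigenvalues i

theorem Matrix.IsHermitian.exists_dotProduct_mulVec_eq_iInf [Nonempty ι] (hA : A.IsHermitian) :
    ∃ v : ι → ℝ, v ⬝ᵥ v = 1 ∧ v ⬝ᵥ A *ᵥ v = ⨅ i, hA.eigenvalues i := by
  obtain ⟨i, hi⟩ := exists_eq_ciInf_of_finite (f := hA.eigenvalues)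
  exact hi ▸ hA.exists_dotProduct_mulVec_eq_eigenvalues i

theorem Matrix.IsHermitian.posDef_iff_iInf_eigenvalues_pos [Nonempty ι] (hA : A.IsHermitian) :
    A.PosDef ↔ 0 < ⨅ i, hA.eigenvalues i := by
  rw [hA.posDef_iff_eigenvalues_pos]
  refine ⟨fun h => ?_, fun h i => h.trans_le (ciInf_le (Set.finite_range _).bddBelow i)⟩
  obtain ⟨i, hi⟩ := exists_eq_ciInf_of_finite (f := hA.eigenvalues)
  exact hi ▸ h i

end RayleighBounds

section Pencil

variable {ι κ : Type*} [Fintype ι] [Fintype κ]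

theorem Matrix.dotProduct_add_smul_transpose_mul_self_mulVec
    (H : Matrix ι ι ℝ) (J : Matrix κ ι ℝ) (γ : ℝ) (v : ι → ℝ) :
    v ⬝ᵥ (H + γ • (Jᵀ * J)) *ᵥ v = v ⬝ᵥ H *ᵥ v + γ * (J *ᵥ v ⬝ᵥ J *ᵥ v) := by
  rw [add_mulVec, smul_mulVec, dotProduct_add, dotProduct_smul, ← mulVec_mulVec,
    dotProduct_mulVec v Jᵀ, vecMul_transpose, smul_eq_mul]

theorem isCompact_setOf_dotProduct_self_eq_one :
    IsCompact {v : ι → ℝ | v ⬝ᵥ v = 1} := by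
  refine Metric.isCompact_of_isClosed_isBounded
    (isClosed_eq (by fun_prop) continuous_const) ?_
  refine (Metric.isBounded_closedBall (x := (0 : ι → ℝ)) (r := 1)).subset fun v hv => ?_
  rw [mem_closedBall_zero_iff, pi_norm_le_iff_of_nonneg zero_le_one]
  intro i
  have h : v i * v i ≤ v ⬝ᵥ v :=
    Finset.single_le_sum (f := fun j => v j * v j) (fun j _ => mul_self_nonneg _)
      (Finset.mem_univ i)
  have hv1 : v ⬝ᵥ v = 1 := hv
  rw [Real.norm_eq_abs, ← sq_le_one_iff_abs_le_one]
  linarith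

/-- Finsler's lemma: a form that is positive on the kernel of `J` becomes positive definite
after adding a large multiple of `JᵀJ`. -/
theorem Matrix.exists_nonneg_posDef_add_smul_transpose_mul_self
    [DecidableEq ι] (H : Matrix ι ι ℝ) (J : Matrix κ ι ℝ)
    (hpos : ∀ v : ι → ℝ, v ≠ 0 → J *ᵥ v = 0 → 0 < v ⬝ᵥ H *ᵥ v)
    (hherm : ∀ γ : ℝ, (H + γ • (Jᵀ * J)).IsHermitian) :
    ∃ γ : ℝ, 0 ≤ γ ∧ (H + γ • (Jᵀ * J)).PosDef := by
  rcases isEmpty_or_nonempty ι with hι | hι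
  · exact ⟨0, le_rfl, .of_dotProduct_mulVec_pos (hherm 0)
      fun x hx => (hx (Subsingleton.elim _ _)).elim⟩
  have hJpos : ∀ v : ι → ℝ, v ⬝ᵥ v = 1 → v ⬝ᵥ H *ᵥ v ≤ 0 → 0 < J *ᵥ v ⬝ᵥ J *ᵥ v := by
    intro v hv hH
    refine (Finset.sum_nonneg fun i _ => mul_self_nonneg _).lt_of_ne' fun h => ?_
    refine (hpos v ?_ (dotProduct_self_eq_zero.1 h)).not_ge hH
    rintro rfl
    simp at hv
  have hK : IsCompact {v : ι → ℝ | v ⬝ᵥ v = 1 ∧ v ⬝ᵥ H *ᵥ v ≤ 0} :=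
    isCompact_setOf_dotProduct_self_eq_one.inter_right
      (isClosed_le (f := fun v : ι → ℝ => v ⬝ᵥ H *ᵥ v) (by fun_prop) continuous_const)
  have hcont : ContinuousOn (fun v : ι → ℝ => -(v ⬝ᵥ H *ᵥ v) / (J *ᵥ v ⬝ᵥ J *ᵥ v))
      {v : ι → ℝ | v ⬝ᵥ v = 1 ∧ v ⬝ᵥ H *ᵥ v ≤ 0} :=
    ContinuousOn.div (by fun_prop) (by fun_prop) fun v hv => (hJpos v hv.1 hv.2).ne'
  obtain ⟨c, hc⟩ := (hK.image_of_continuousOn hcont).bddAbove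
  have hγ : 0 ≤ max c 0 + 1 := by positivity
  refine ⟨max c 0 + 1, hγ, (hherm _).posDef_iff_iInf_eigenvalues_pos.2 ?_⟩
  obtain ⟨v, hv, hvmin⟩ := (hherm (max c 0 + 1)).exists_dotProduct_mulVec_eq_iInf
  rw [← hvmin, dotProduct_add_smul_transpose_mul_self_mulVec]
  rcases le_or_gt (v ⬝ᵥ H *ᵥ v) 0 with hH | hH
  · have hJv := hJpos v hv hH
    have h := hc (Set.mem_image_of_mem _ ⟨hv, hH⟩)
    rw [div_le_iff₀ hJv] at h
    nlinarith [mul_le_mul_of_nonneg_right (le_max_left c 0) hJv.le]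
  · have : 0 ≤ J *ᵥ v ⬝ᵥ J *ᵥ v := Finset.sum_nonneg fun i _ => mul_self_nonneg _
    positivity

variable [DecidableEq ι] [Nonempty ι] {A B : Matrix ι ι ℝ}

theorem Matrix.continuous_iSup_eigenvalues_add_smul
    (h : ∀ γ : ℝ, (A + γ • B).IsHermitian) :
    Continuous fun γ => ⨆ i, (h γ).eigenvalues i := by
  rw [← continuousOn_univ]
  refine ConvexOn.continuousOn isOpen_univ ⟨convex_univ, fun x _ y _ a b ha hb hab => ?_⟩
  obtain ⟨v, hv, hvmax⟩ := (h (a • x + b • y)).exists_dotProduct_mulVec_eq_iSup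
  have hx := (h x).dotProduct_mulVec_le_iSup_eigenvalues v
  have hy := (h y).dotProduct_mulVec_le_iSup_eigenvalues v
  simp only [hv, mul_one, add_mulVec, smul_mulVec, dotProduct_add, dotProduct_smul,
    smul_eq_mul] at hx hy hvmax ⊢
  rw [← hvmax]
  linear_combination a * hx + b * hy - (v ⬝ᵥ A *ᵥ v) * hab

theorem Matrix.continuous_iInf_eigenvalues_add_smul
    (h : ∀ γ : ℝ, (A + γ • B).IsHermitian) :
    Continuous fun γ => ⨅ i, (h γ).eigenvalues i := by
  rw [← continuousOn_univ]
  refine ConcaveOn.continuousOn isOpen_univ ⟨convex_univ, fun x _ y _ a b ha hb hab => ?_⟩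
  obtain ⟨v, hv, hvmin⟩ := (h (a • x + b • y)).exists_dotProduct_mulVec_eq_iInf
  have hx := (h x).iInf_eigenvalues_mul_le_dotProduct_mulVec v
  have hy := (h y).iInf_eigenvalues_mul_le_dotProduct_mulVec v
  simp only [hv, mul_one, add_mulVec, smul_mulVec, dotProduct_add, dotProduct_smul,
    smul_eq_mul] at hx hy hvmin ⊢
  rw [← hvmin]
  linear_combination a * hx + b * hy + (v ⬝ᵥ A *ᵥ v) * hab

end Pencil

theorem Matrix.exists_dotProduct_self_eq_one_mulVec_eq_zero {n m : ℕ} (hmn : m < n)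
    (J : Matrix (Fin m) (Fin n) ℝ) : ∃ w : Fin n → ℝ, w ⬝ᵥ w = 1 ∧ J *ᵥ w = 0 := by
  obtain ⟨w, hw, hw0⟩ := (Submodule.ne_bot_iff _).1
    (J.mulVecLin.ker_ne_bot_of_finrank_lt (by simpa using hmn))
  have hpos : 0 < w ⬝ᵥ w := (Finset.sum_nonneg fun i _ => mul_self_nonneg _).lt_of_ne'
    fun h => hw0 (dotProduct_self_eq_zero.1 h)
  refine ⟨(√(w ⬝ᵥ w))⁻¹ • w, ?_, ?_⟩
  · rw [smul_dotProduct, dotProduct_smul, smul_eq_mul, smul_eq_mul, ← mul_assoc, ← mul_inv,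
      Real.mul_self_sqrt hpos.le, inv_mul_cancel₀ hpos.ne']
  · have hJw : J *ᵥ w = 0 := hw
    rw [mulVec_smul, hJw, smul_zero]

/-- The set `G = {γ ≥ 0 : H_γ SPD}` is nonempty and `γ ↦ κ(H_γ)` attains its infimum on `G`. -/
theorem condition_number_attains_min
    {n m : ℕ} (hmn : m < n)
    (Ht : Matrix (Fin n) (Fin n) ℝ) (hHt : Ht.IsHermitian)
    (J : Matrix (Fin m) (Fin n) ℝ) (hJ : J.rank = m)
    (hpos : ∀ v : Fin n → ℝ, v ≠ 0 → J.mulVec v = 0 → 0 < v ⬝ᵥ Ht.mulVec v)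
    (hHγ : ∀ γ : ℝ, (Ht + γ • (Jᵀ * J)).IsHermitian) :
    ({γ : ℝ | 0 ≤ γ ∧ (Ht + γ • (Jᵀ * J)).PosDef}.Nonempty) ∧
    ∃ γstar ∈ {γ : ℝ | 0 ≤ γ ∧ (Ht + γ • (Jᵀ * J)).PosDef},
      ∀ γ ∈ {γ : ℝ | 0 ≤ γ ∧ (Ht + γ • (Jᵀ * J)).PosDef},
        (⨆ i, (hHγ γstar).eigenvalues i) / (⨅ i, (hHγ γstar).eigenvalues i) ≤
          (⨆ i, (hHγ γ).eigenvalues i) / (⨅ i, (hHγ γ).eigenvalues i) := by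
  obtain ⟨γ₀, hγ₀, hpd₀⟩ := exists_nonneg_posDef_add_smul_transpose_mul_self Ht J hpos hHγ
  refine ⟨⟨γ₀, hγ₀, hpd₀⟩, ?_⟩
  have : Nonempty (Fin n) := ⟨⟨m, hmn⟩⟩
  by_cases hJ0 : ∀ v, J *ᵥ v = 0
  · obtain rfl : J = 0 := Matrix.ext_of_mulVec_single fun i => by simp [hJ0, -mulVec_single]
    refine ⟨γ₀, ⟨hγ₀, hpd₀⟩, fun γ _ => ?_⟩
    simp
  push Not at hJ0
  obtain ⟨u, hu⟩ := hJ0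
  have hJu : 0 < J *ᵥ u ⬝ᵥ J *ᵥ u := (Finset.sum_nonneg fun i _ => mul_self_nonneg _).lt_of_ne'
    fun h => hu (dotProduct_self_eq_zero.1 h)
  obtain ⟨w, hw, hJw⟩ := exists_dotProduct_self_eq_one_mulVec_eq_zero hmn J
  have hwpos : 0 < w ⬝ᵥ Ht *ᵥ w := hpos w (by rintro rfl; simp at hw) hJw
  have hsup_cont := continuous_iSup_eigenvalues_add_smul hHγ
  have hinf_cont := continuous_iInf_eigenvalues_add_smul hHγ
  have hsup (γ : ℝ) (v : Fin n → ℝ) := (hHγ γ).dotProduct_mulVec_le_iSup_eigenvalues v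
  have hinf (γ : ℝ) (v : Fin n → ℝ) := (hHγ γ).iInf_eigenvalues_mul_le_dotProduct_mulVec v
  have hpd (γ : ℝ) := (hHγ γ).posDef_iff_iInf_eigenvalues_pos
  set lmax : ℝ → ℝ := fun γ => ⨆ i, (hHγ γ).eigenvalues i
  set lmin : ℝ → ℝ := fun γ => ⨅ i, (hHγ γ).eigenvalues i
  change ∃ γstar ∈ {γ : ℝ | 0 ≤ γ ∧ (Ht + γ • (Jᵀ * J)).PosDef},
    ∀ γ ∈ {γ : ℝ | 0 ≤ γ ∧ (Ht + γ • (Jᵀ * J)).PosDef},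
      lmax γstar / lmin γstar ≤ lmax γ / lmin γ
  replace hpd : ∀ γ, (Ht + γ • (Jᵀ * J)).PosDef ↔ 0 < lmin γ := hpd
  replace hsup : ∀ γ v, v ⬝ᵥ Ht *ᵥ v + γ * (J *ᵥ v ⬝ᵥ J *ᵥ v) ≤ lmax γ * (v ⬝ᵥ v) :=
    fun γ v => dotProduct_add_smul_transpose_mul_self_mulVec Ht J γ v ▸ hsup γ v
  replace hinf : ∀ γ v, lmin γ * (v ⬝ᵥ v) ≤ v ⬝ᵥ Ht *ᵥ v + γ * (J *ᵥ v ⬝ᵥ J *ᵥ v) :=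
    fun γ v => dotProduct_add_smul_transpose_mul_self_mulVec Ht J γ v ▸ hinf γ v
  have hlmax (γ : ℝ) : w ⬝ᵥ Ht *ᵥ w ≤ lmax γ := by simpa [hw, hJw] using hsup γ w
  have hlmin (γ : ℝ) : lmin γ ≤ w ⬝ᵥ Ht *ᵥ w := by simpa [hw, hJw] using hinf γ w
  have hlmin₀ : 0 < lmin γ₀ := (hpd γ₀).1 hpd₀
  set K := lmax γ₀ / lmin γ₀
  have hKpos : 0 < K := div_pos (hwpos.trans_le (hlmax γ₀)) hlmin₀
  set T : Set ℝ := {γ | 0 ≤ γ ∧ lmax γ ≤ K * lmin γ}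
  have hTpos : ∀ γ ∈ T, 0 < lmin γ := fun γ hγ =>
    pos_of_mul_pos_right ((hwpos.trans_le (hlmax γ)).trans_le hγ.2) hKpos.le
  have hγ₀T : γ₀ ∈ T := ⟨hγ₀, (div_mul_cancel₀ _ hlmin₀.ne').ge⟩
  have hTclosed : IsClosed T :=
    (isClosed_le continuous_const continuous_id).inter
      (isClosed_le hsup_cont (continuous_const.mul hinf_cont))
  have hTsub : T ⊆ Set.Icc 0
      ((K * (w ⬝ᵥ Ht *ᵥ w) * (u ⬝ᵥ u) - u ⬝ᵥ Ht *ᵥ u) / (J *ᵥ u ⬝ᵥ J *ᵥ u)) := by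
    refine fun γ hγ => ⟨hγ.1, (le_div_iff₀ hJu).2 ?_⟩
    have huu : 0 ≤ u ⬝ᵥ u := Finset.sum_nonneg fun i _ => mul_self_nonneg _
    have h := mul_le_mul_of_nonneg_right
      (hγ.2.trans (mul_le_mul_of_nonneg_left (hlmin γ) hKpos.le)) huu
    linarith [hsup γ u]
  have hTcompact : IsCompact T := isCompact_Icc.of_isClosed_subset hTclosed hTsub
  obtain ⟨γs, hγs, hmin⟩ := hTcompact.exists_isMinOn ⟨γ₀, hγ₀T⟩
    (hsup_cont.continuousOn.div hinf_cont.continuousOn fun γ hγ => (hTpos γ hγ).ne')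
  refine ⟨γs, ⟨hγs.1, (hpd γs).2 (hTpos γs hγs)⟩, fun γ hγ => ?_⟩
  by_cases hγT : γ ∈ T
  · exact hmin hγT
  · have hlt : K * lmin γ < lmax γ := not_le.1 fun h => hγT ⟨hγ.1, h⟩
    exact (hmin hγ₀T).trans ((le_div_iff₀ ((hpd γ).1 hγ.2)).2 hlt.le)
end

section
/- Let H̃ be an n×n real symmetric positive definite matrix, J an m×n real matrix with full row rank (rank(J) = m), and γ > 0. Then H_γ := H̃ + γ JᵀJ is symmetric positive definite, JH̃⁻¹Jᵀ is symmetric positive definite (hence invertible), and with C := (1/γ)·(JH̃⁻¹Jᵀ)⁻¹, the matrix I + C is invertible and γ·J H_γ⁻¹ Jᵀ = (I + C)⁻¹. -/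
open Matrix

/-- A matrix over a field whose rank is its number of rows has an injective left action. -/
theorem Matrix.vecMul_injective_of_rank_eq {K ι κ : Type*} [Field K] [Fintype ι] [Fintype κ]
    {A : Matrix ι κ K} (hA : A.rank = Fintype.card ι) : Function.Injective A.vecMul := by
  rw [Matrix.vecMul_injective_iff, linearIndependent_iff_card_eq_finrank_span, ← hA,
    Matrix.rank_eq_finrank_span_row, Set.finrank]

/-- Push-through identity for a symmetric low-rank update of an invertible matrix. -/
theorem Matrix.mul_inv_add_smul_mul_transpose_mul {K ι κ : Type*} [Field K]
    [Fintype ι] [DecidableEq ι] [Fintype κ] [DecidableEq κ]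
    {H : Matrix κ κ K} {J : Matrix ι κ K} {c : K} (hH : IsUnit H.det)
    (hG : IsUnit (H + c • (Jᵀ * J)).det) :
    J * (H + c • (Jᵀ * J))⁻¹ * Jᵀ * (1 + c • (J * H⁻¹ * Jᵀ)) = J * H⁻¹ * Jᵀ := by
  have key : Jᵀ * (1 + c • (J * H⁻¹ * Jᵀ)) = (H + c • (Jᵀ * J)) * (H⁻¹ * Jᵀ) := by
    rw [Matrix.add_mul, Matrix.mul_nonsing_inv_cancel_left _ _ hH]
    simp [Matrix.mul_add, Matrix.mul_assoc]
  rw [Matrix.mul_assoc, key, Matrix.mul_assoc, Matrix.nonsing_inv_mul_cancel_left _ _ hG,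
    Matrix.mul_assoc]

/-- For SPD `H̃`, full-row-rank `J` and `γ > 0`: `H_γ = H̃ + γJᵀJ` is SPD, `JH̃⁻¹Jᵀ` is SPD
(hence invertible), `I + C` with `C = (1/γ)(JH̃⁻¹Jᵀ)⁻¹` is invertible, and
`γ·J H_γ⁻¹ Jᵀ = (I + C)⁻¹`. -/
theorem schur_complement_searle_form
    {n m : ℕ} (Ht : Matrix (Fin n) (Fin n) ℝ) (hHt : Ht.PosDef)
    (J : Matrix (Fin m) (Fin n) ℝ) (hJ : J.rank = m)
    (γ : ℝ) (hγ : 0 < γ) :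
    (Ht + γ • (Jᵀ * J)).PosDef ∧
    (J * Ht⁻¹ * Jᵀ).PosDef ∧
    IsUnit ((1 : Matrix (Fin m) (Fin m) ℝ) + (1 / γ) • (J * Ht⁻¹ * Jᵀ)⁻¹).det ∧
    γ • (J * (Ht + γ • (Jᵀ * J))⁻¹ * Jᵀ) =
      ((1 : Matrix (Fin m) (Fin m) ℝ) + (1 / γ) • (J * Ht⁻¹ * Jᵀ)⁻¹)⁻¹ := by
  have hG : (Ht + γ • (Jᵀ * J)).PosDef := by
    refine hHt.add_posSemidef (Matrix.PosSemidef.smul ?_ hγ.le)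
    simpa using Matrix.posSemidef_conjTranspose_mul_self J
  have hS : (J * Ht⁻¹ * Jᵀ).PosDef := by
    simpa using hHt.inv.mul_mul_conjTranspose_same
      (Matrix.vecMul_injective_of_rank_eq (A := J) (by simpa using hJ))
  have hSu : IsUnit (J * Ht⁻¹ * Jᵀ).det := hS.det_pos.ne'.isUnit
  have push := Matrix.mul_inv_add_smul_mul_transpose_mul (J := J) (c := γ)
    hHt.det_pos.ne'.isUnit hG.det_pos.ne'.isUnit
  set S := J * Ht⁻¹ * Jᵀ
  have hC : (1 : Matrix (Fin m) (Fin m) ℝ) + γ • S = γ • ((1 + (1 / γ) • S⁻¹) * S) := by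
    rw [Matrix.add_mul, Matrix.smul_mul, Matrix.nonsing_inv_mul _ hSu, smul_add, smul_smul,
      mul_one_div_cancel hγ.ne', one_smul, Matrix.one_mul, add_comm]
  have hinv : γ • (J * (Ht + γ • (Jᵀ * J))⁻¹ * Jᵀ) * (1 + (1 / γ) • S⁻¹) = 1 := by
    rw [hC, Matrix.mul_smul, ← Matrix.smul_mul, ← Matrix.mul_assoc] at push
    rw [← Matrix.mul_nonsing_inv_cancel_right S (γ • _ * _) hSu, push,
      Matrix.mul_nonsing_inv _ hSu]
  exact ⟨hG, hS, Matrix.isUnit_det_of_left_inverse hinv, (Matrix.inv_eq_left_inv hinv).symm⟩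
end

section
/- Let H̃ be an n×n real symmetric positive definite matrix, J an m×n real matrix with full row rank, and γ > 0. Set S_γ := γ·J(H̃ + γ JᵀJ)⁻¹Jᵀ. Then every eigenvalue λ of S_γ is real, satisfies 0 < λ < 1, and |λ − 1| ≤ 1/(γ·λ_min(JH̃⁻¹Jᵀ)); in particular the eigenvalues of S_γ converge to 1 as γ → ∞ with an error term that decays as 1/γ. -/
open Matrix

/-- A complex spectral value of a real symmetric matrix is real, and has a real eigenvector. -/
theorem Matrix.IsHermitian.exists_real_eigenvector {ι : Type*} [Fintype ι] [DecidableEq ι]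
    {S : Matrix ι ι ℝ} (hS : S.IsHermitian) {μ : ℂ}
    (hμ : μ ∈ spectrum ℂ (S.map Complex.ofReal)) :
    ∃ lam : ℝ, μ = lam ∧ ∃ v : ι → ℝ, v ≠ 0 ∧ S *ᵥ v = lam • v := by
  have hroot : (S.map Complex.ofRealHom).charpoly.IsRoot μ :=
    Matrix.mem_spectrum_iff_isRoot_charpoly.mp hμ
  rw [Matrix.charpoly_map, hS.charpoly_eq, Polynomial.IsRoot, Polynomial.eval_map,
    Polynomial.eval₂_finsetProd, Finset.prod_eq_zero_iff] at hroot
  obtain ⟨i, -, hi⟩ := hroot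
  refine ⟨hS.eigenvalues i, by simpa [sub_eq_zero] using hi, hS.eigenvectorBasis i, ?_,
    hS.mulVec_eigenvectorBasis i⟩
  simpa using hS.eigenvectorBasis.orthonormal.ne_zero i

/-- The smallest eigenvalue of a real symmetric matrix bounds its Rayleigh quotient from below. -/
theorem Matrix.IsHermitian.iInf_eigenvalues_mul_le {ι : Type*} [Fintype ι] [DecidableEq ι]
    {W : Matrix ι ι ℝ} (hW : W.IsHermitian) (v : ι → ℝ) :
    (⨅ i, hW.eigenvalues i) * (v ⬝ᵥ v) ≤ v ⬝ᵥ (W *ᵥ v) := by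
  set c := ⨅ i, hW.eigenvalues i with hc
  have hpsd : (W - c • 1).PosSemidef := by
    refine posSemidef_iff_isHermitian_and_spectrum_nonneg.mpr
      ⟨hW.sub (isHermitian_one.smul (IsSelfAdjoint.all c)), fun x hx ↦ ?_⟩
    have hx' : x + c ∈ spectrum ℝ W := by
      rw [spectrum.add_mem_iff, neg_add_eq_sub, Algebra.algebraMap_eq_smul_one]
      exact hx
    rw [hW.spectrum_real_eq_range_eigenvalues] at hx'
    obtain ⟨i, hi⟩ := hx'
    have := ciInf_le (Set.finite_range hW.eigenvalues).bddBelow i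
    simp only [Set.mem_ofPred_eq]
    linarith
  have := hpsd.dotProduct_mulVec_nonneg v
  simp only [star_trivial, sub_mulVec, smul_mulVec, one_mulVec, dotProduct_sub, dotProduct_smul,
    smul_eq_mul] at this
  linarith

theorem Matrix.vecMul_injective_of_rank_eq_s10 {n m : ℕ} {J : Matrix (Fin m) (Fin n) ℝ}
    (hJ : J.rank = m) : Function.Injective J.vecMul := by
  rw [Matrix.vecMul_injective_iff, linearIndependent_iff_card_eq_finrank_span, Fintype.card_fin,
    Set.finrank, ← rank_eq_finrank_span_row, hJ]

theorem Matrix.PosDef.add_smul_transpose_mul_self {ι κ : Type*} [Fintype ι] [Fintype κ]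
    {H : Matrix ι ι ℝ} (hH : H.PosDef) (J : Matrix κ ι ℝ) {γ : ℝ} (hγ : 0 ≤ γ) :
    (H + γ • (Jᵀ * J)).PosDef := by
  have h := posSemidef_conjTranspose_mul_self J
  rw [conjTranspose_eq_transpose_of_trivial] at h
  exact hH.add_posSemidef (h.smul hγ)

/-- The scaled Schur complement `S` satisfies `(1 + γ W) S = γ W` with `W = J H⁻¹ Jᵀ`. -/
theorem Matrix.one_add_smul_mul_schur {ι κ : Type*} [Fintype ι] [DecidableEq ι] [Fintype κ]
    [DecidableEq κ] {H : Matrix ι ι ℝ} {J : Matrix κ ι ℝ} {γ : ℝ} (hH : IsUnit H.det)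
    (hA : IsUnit (H + γ • (Jᵀ * J)).det) :
    (1 + γ • (J * H⁻¹ * Jᵀ)) * (γ • (J * (H + γ • (Jᵀ * J))⁻¹ * Jᵀ)) =
      γ • (J * H⁻¹ * Jᵀ) := by
  have key : (1 + γ • (J * H⁻¹ * Jᵀ)) * J = J * H⁻¹ * (H + γ • (Jᵀ * J)) := by
    rw [Matrix.add_mul, Matrix.mul_add, nonsing_inv_mul_cancel_right _ _ hH]
    simp [Matrix.mul_assoc]
  rw [Matrix.mul_smul, ← Matrix.mul_assoc, ← Matrix.mul_assoc, key,
    mul_nonsing_inv_cancel_right _ _ hA]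

/-- Every eigenvalue `λ` of `S_γ = γ·J(H̃ + γJᵀJ)⁻¹Jᵀ` is real, lies in `(0,1)`, and
satisfies `|λ − 1| ≤ 1/(γ·λ_min(JH̃⁻¹Jᵀ))`. -/
theorem schur_eigenvalues_converge_to_one
    {n m : ℕ} (Ht : Matrix (Fin n) (Fin n) ℝ) (hHt : Ht.PosDef)
    (J : Matrix (Fin m) (Fin n) ℝ) (hJ : J.rank = m)
    (γ : ℝ) (hγ : 0 < γ)
    (hW : (J * Ht⁻¹ * Jᵀ).IsHermitian) :
    ∀ μ ∈ spectrum ℂ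
        ((γ • (J * (Ht + γ • (Jᵀ * J))⁻¹ * Jᵀ)).map (Complex.ofReal)),
      ∃ lam : ℝ, μ = (lam : ℂ) ∧ 0 < lam ∧ lam < 1 ∧
        |lam - 1| ≤ 1 / (γ * ⨅ i, hW.eigenvalues i) := by
  intro μ hμ
  have hA := hHt.add_smul_transpose_mul_self J hγ.le
  have hS : (γ • (J * (Ht + γ • (Jᵀ * J))⁻¹ * Jᵀ)).IsHermitian :=
    (isHermitian_mul_mul_conjTranspose J hA.inv.isHermitian).smul (IsSelfAdjoint.all γ)
  have hWpos : (J * Ht⁻¹ * Jᵀ).PosDef :=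
    hHt.inv.mul_mul_conjTranspose_same (vecMul_injective_of_rank_eq_s10 hJ)
  obtain ⟨lam, rfl, v, hv, hSv⟩ := hS.exists_real_eigenvector hμ
  have hkey := congrArg (fun M ↦ v ⬝ᵥ (M *ᵥ v))
    (one_add_smul_mul_schur hHt.det_pos.ne'.isUnit hA.det_pos.ne'.isUnit)
  rw [← mulVec_mulVec v (1 + _), hSv] at hkey
  simp only [mulVec_smul, add_mulVec, one_mulVec, smul_mulVec,
    dotProduct_smul, dotProduct_add, smul_eq_mul] at hkey
  have hmin := hW.iInf_eigenvalues_mul_le v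
  have hw : 0 < v ⬝ᵥ ((J * Ht⁻¹ * Jᵀ) *ᵥ v) := hWpos.dotProduct_mulVec_pos hv
  have hvv : 0 < v ⬝ᵥ v := by simpa using dotProduct_star_self_pos_iff.mpr hv
  have hc : 0 < ⨅ i, hW.eigenvalues i := by
    obtain ⟨i, -⟩ := Function.ne_iff.mp hv
    have : Nonempty (Fin m) := ⟨i⟩
    obtain ⟨j, hj⟩ := exists_eq_ciInf_of_finite (f := hW.eigenvalues)
    exact hj ▸ hWpos.eigenvalues_pos j
  generalize v ⬝ᵥ ((J * Ht⁻¹ * Jᵀ) *ᵥ v) = w at *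
  generalize v ⬝ᵥ v = s at *
  generalize (⨅ i, hW.eigenvalues i) = c at *
  have hγw : 0 < γ * w := mul_pos hγ hw
  have hlam : lam = γ * w / (s + γ * w) := by
    rw [eq_div_iff (by positivity)]
    exact hkey
  have hlt : lam < 1 := by
    rw [hlam, div_lt_one (by positivity)]
    linarith
  refine ⟨lam, rfl, hlam ▸ by positivity, hlt, ?_⟩
  have hsub : 1 - lam = s / (s + γ * w) := by
    rw [hlam]
    field_simp
    ring
  rw [abs_sub_comm, abs_of_pos (by linarith), hsub, div_le_div_iff₀ (by positivity) (by positivity)]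
  nlinarith [mul_le_mul_of_nonneg_left hmin hγ.le]
end

section
/- Let H̃ be an n×n real symmetric positive definite matrix, J an m×n real matrix with full row rank, and γ > 0. Then the spectrum of S_γ := γ·J(H̃ + γJᵀJ)⁻¹Jᵀ is exactly the set {γ/(γ + μ) : μ is an eigenvalue of (JH̃⁻¹Jᵀ)⁻¹} (with matching multiplicities), i.e., S_γ and (I + (1/γ)(JH̃⁻¹Jᵀ)⁻¹)⁻¹ have the same eigenvalues. -/
open Matrix

/-- A matrix of full row rank acts injectively on row vectors. -/
theorem Matrix.vecMul_injective_of_rank_eq_card {m n K : Type*} [Fintype m] [Fintype n] [Field K]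
    {A : Matrix m n K} (hA : A.rank = Fintype.card m) : Function.Injective A.vecMul := by
  rw [Matrix.vecMul_injective_iff, linearIndependent_iff_card_eq_finrank_span, Set.finrank,
    ← A.rank_eq_finrank_span_row, hA]

/-- The scaled Schur complement `γ • J (H + γ Jᵀ J)⁻¹ Jᵀ` is a right inverse of
`1 + γ⁻¹ (J H⁻¹ Jᵀ)⁻¹`. -/
theorem Matrix.one_add_smul_inv_mul_schur {m n K : Type*} [Fintype m] [DecidableEq m]
    [Fintype n] [DecidableEq n] [Field K] {H : Matrix n n K} {J : Matrix m n K} {γ : K}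
    (hγ : γ ≠ 0) (hH : IsUnit H) (hA : IsUnit (H + γ • (Jᵀ * J)))
    (hK : IsUnit (J * H⁻¹ * Jᵀ)) :
    (1 + (1 / γ) • (J * H⁻¹ * Jᵀ)⁻¹) * (γ • (J * (H + γ • (Jᵀ * J))⁻¹ * Jᵀ)) = 1 := by
  rw [Matrix.isUnit_iff_isUnit_det] at hH hA hK
  set A := H + γ • (Jᵀ * J) with hAdef
  set K₀ := J * H⁻¹ * Jᵀ with hK₀
  have push : J * H⁻¹ * A = (1 + γ • K₀) * J := by
    rw [hAdef, hK₀, Matrix.mul_add, Matrix.nonsing_inv_mul_cancel_right _ _ hH, Matrix.add_mul,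
      Matrix.one_mul, Matrix.mul_smul, Matrix.smul_mul, ← Matrix.mul_assoc]
  have schur : (1 + γ • K₀) * (J * A⁻¹ * Jᵀ) = K₀ := by
    rw [← Matrix.mul_assoc, ← Matrix.mul_assoc, ← push,
      Matrix.mul_nonsing_inv_cancel_right _ _ hA]
  have factor : 1 + (1 / γ) • K₀⁻¹ = (1 / γ) • (K₀⁻¹ * (1 + γ • K₀)) := by
    rw [Matrix.mul_add, Matrix.mul_smul, Matrix.nonsing_inv_mul _ hK, Matrix.mul_one, smul_add,
      smul_smul, one_div_mul_cancel hγ, one_smul, add_comm]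
  rw [factor, Matrix.smul_mul, Matrix.mul_smul, smul_smul, one_div_mul_cancel hγ, one_smul,
    Matrix.mul_assoc, schur, Matrix.nonsing_inv_mul _ hK]

open scoped Pointwise in
/-- The spectrum of a scaled resolvent `(1 + γ⁻¹ M)⁻¹` is the image of that of `M`. -/
theorem Matrix.spectrum_inv_one_add_smul {m K : Type*} [Fintype m] [DecidableEq m] [Field K]
    {M : Matrix m m K} {γ : K} (hγ : γ ≠ 0) (hM : IsUnit (1 + (1 / γ) • M)) :
    spectrum K (1 + (1 / γ) • M)⁻¹ = (fun μ : K => γ / (γ + μ)) '' spectrum K M := by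
  have hspec : spectrum K (1 + (1 / γ) • M) = (fun μ : K => 1 + (1 / γ) * μ) '' spectrum K M := by
    rw [← map_one (algebraMap K (Matrix m m K)), ← spectrum.singleton_add_eq,
      show (1 / γ) • M = Units.mk0 (1 / γ) (one_div_ne_zero hγ) • M from rfl,
      spectrum.unit_smul_eq_smul, Set.singleton_add, ← Set.image_smul, Set.image_image]
    rfl
  obtain ⟨B, hB⟩ := hM
  rw [← hB, ← Matrix.coe_units_inv, ← spectrum.map_inv, hB, hspec, ← Set.image_inv_eq_inv,
    Set.image_image]
  refine Set.image_congr fun μ _ => ?_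
  field_simp

/-- The spectrum of `S_γ = γ·J(H̃ + γJᵀJ)⁻¹Jᵀ` is exactly
`{γ/(γ+μ) : μ eigenvalue of (JH̃⁻¹Jᵀ)⁻¹}`, with matching multiplicities: `S_γ` and
`(I + (1/γ)(JH̃⁻¹Jᵀ)⁻¹)⁻¹` have the same characteristic polynomial, and the spectrum of
`S_γ` is the image of the spectrum of `(JH̃⁻¹Jᵀ)⁻¹` under `μ ↦ γ/(γ+μ)`. -/
theorem schur_spectrum_description
    {n m : ℕ} (Ht : Matrix (Fin n) (Fin n) ℝ) (hHt : Ht.PosDef)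
    (J : Matrix (Fin m) (Fin n) ℝ) (hJ : J.rank = m)
    (γ : ℝ) (hγ : 0 < γ) :
    (γ • (J * (Ht + γ • (Jᵀ * J))⁻¹ * Jᵀ)).charpoly =
      (((1 : Matrix (Fin m) (Fin m) ℝ) + (1 / γ) • (J * Ht⁻¹ * Jᵀ)⁻¹)⁻¹).charpoly ∧
    spectrum ℝ (γ • (J * (Ht + γ • (Jᵀ * J))⁻¹ * Jᵀ)) =
      (fun μ : ℝ => γ / (γ + μ)) '' spectrum ℝ ((J * Ht⁻¹ * Jᵀ)⁻¹) := by
  have hInj : Function.Injective J.vecMul :=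
    Matrix.vecMul_injective_of_rank_eq_card (by rw [hJ, Fintype.card_fin])
  have hK : IsUnit (J * Ht⁻¹ * Jᵀ) := by
    simpa using (hHt.inv.mul_mul_conjTranspose_same hInj).isUnit
  have hA : IsUnit (Ht + γ • (Jᵀ * J)) := by
    have hJJ : (Jᵀ * J).PosSemidef := by simpa using Matrix.posSemidef_conjTranspose_mul_self J
    exact (hHt.add_posSemidef (hJJ.smul hγ.le)).isUnit
  have hmul := Matrix.one_add_smul_inv_mul_schur hγ.ne' hHt.isUnit hA hK
  rw [← Matrix.inv_eq_right_inv hmul]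
  exact ⟨rfl, Matrix.spectrum_inv_one_add_smul hγ.ne' (IsUnit.of_mul_eq_one _ hmul)⟩
end
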